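/- Let T_0 ∈ (π, 2π). For T ≥ T_0 define C(T) := r((0, T_0)) ∪ r((T_0, T) − π) ⊆ ℝ/(2πℤ). Then inf { T ≥ T_0 : μ( (C(T))ᶜ ) = 0 } = 3π. -/

import Mathlib

open MeasureTheory Set Real Filter Topology

noncomputable section

instance : Fact (0 < 2 * Real.pi) := ⟨by positivity⟩

/-- The covered set C(T) ⊆ ℝ/(2πℤ) for a single exchange of the observation
endpoint: observation at x = 0 on (0,T₀) and at x = π on (T₀,T), i.e.
C(T) = r((0,T₀)) ∪ r((T₀,T) − π). -/
def covSingle (T0 T : ℝ) : Set (AddCircle (2 * Real.pi)) :=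
  ((fun x : ℝ => ((x : ℝ) : AddCircle (2 * Real.pi))) '' Set.Ioo 0 T0) ∪
  ((fun x : ℝ => ((x - Real.pi : ℝ) : AddCircle (2 * Real.pi))) '' Set.Ioo T0 T)

/-- Corollary 1.9, first part: for π < T₀ < 2π, the optimal control time for a
single exchange of the observation endpoint at time T₀ is 3π. -/
theorem stmt_5 (T0 : ℝ) (hT0 : T0 ∈ Set.Ioo Real.pi (2 * Real.pi)) :
    sInf { T : ℝ | T0 ≤ T ∧ volume (covSingle T0 T)ᶜ = 0 } = 3 * Real.pi := by
  obtain ⟨h1, h2⟩ := hT0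
  have hpi := Real.pi_pos
  have key : { T : ℝ | T0 ≤ T ∧ volume (covSingle T0 T)ᶜ = 0 } = Set.Ici (3 * Real.pi) := by
    ext T
    simp only [Set.mem_setOf_eq, Set.mem_Ici]
    constructor
    · rintro ⟨hT, h0⟩
      by_contra hlt
      rw [not_le] at hlt
      set a := max T0 (T - Real.pi) with ha
      have ha1 : T0 ≤ a := le_max_left _ _
      have ha3 : T - Real.pi ≤ a := le_max_right _ _
      have ha2 : a < 2 * Real.pi := max_lt h2 (by linarith)
      have hopen : IsOpen ((fun x : ℝ => (x : AddCircle (2 * Real.pi))) '' Set.Ioo a (2 * Real.pi)) :=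
        QuotientAddGroup.isOpenMap_coe _ isOpen_Ioo
      have hne : ((fun x : ℝ => (x : AddCircle (2 * Real.pi))) '' Set.Ioo a (2 * Real.pi)).Nonempty :=
        (Set.nonempty_Ioo.2 ha2).image _
      have hpos := hopen.measure_pos volume hne
      have hsub : ((fun x : ℝ => (x : AddCircle (2 * Real.pi))) '' Set.Ioo a (2 * Real.pi))
          ⊆ (covSingle T0 T)ᶜ := by
        rintro _ ⟨x, ⟨hx1, hx2⟩, rfl⟩ hc
        have inj : ∀ y : ℝ, 0 ≤ y → y < 2 * Real.pi →
            ((y : ℝ) : AddCircle (2 * Real.pi)) = (x : AddCircle (2 * Real.pi)) → y = x := by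
          intro y hy1 hy2 h
          exact (AddCircle.coe_eq_coe_iff_of_mem_Ico (a := 0) (p := 2 * Real.pi)
            ⟨hy1, by linarith⟩ ⟨by linarith, by linarith⟩).1 h
        rcases hc with ⟨y, ⟨hy1, hy2⟩, h⟩ | ⟨y, ⟨hy1, hy2⟩, h⟩
        · have := inj y (by linarith) (by linarith) h
          linarith
        · have := inj (y - Real.pi) (by linarith) (by linarith) h
          linarith
      exact (hpos.trans_le (measure_mono hsub)).ne' h0
    · intro hT
      refine ⟨by linarith, ?_⟩
      have hsub : (covSingle T0 T)ᶜ ⊆ {(0 : AddCircle (2 * Real.pi))} := by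
        intro z hz
        obtain ⟨x, ⟨hx1, hx2⟩, rfl⟩ : z ∈ (fun x : ℝ => (x : AddCircle (2 * Real.pi))) ''
            Set.Ico 0 (0 + 2 * Real.pi) := by
          have := AddCircle.coe_image_Ico_eq (2 * Real.pi) 0
          exact this ▸ Set.mem_univ z
        by_contra hne
        have hx0 : x ≠ 0 := by
          rintro rfl
          exact hne rfl
        have hx : 0 < x := lt_of_le_of_ne hx1 hx0.symm
        apply hz
        rcases lt_or_ge x T0 with h | h
        · exact Or.inl ⟨x, ⟨hx, h⟩, rfl⟩
        · refine Or.inr ⟨x + Real.pi, ⟨by linarith, by linarith⟩, ?_⟩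
          simp only [add_sub_cancel_right]
      have hz : volume ({0} : Set (AddCircle (2 * Real.pi))) = 0 := by
        rw [← Metric.closedBall_zero, AddCircle.volume_closedBall, mul_zero,
          min_eq_right (by linarith), ENNReal.ofReal_zero]
      exact measure_mono_null hsub hz
  rw [key, csInf_Ici]
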